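/- arXiv:1812.11650 — 3 statements merged into one kernel-verified Lean document; each statement's English description precedes it below -/
import Mathlib

section
/- For every integer k ≥ 1, all i, s, r, p < k satisfying (r + i) mod k = (p + s) mod k, and every starting slot t0 ∈ ℕ, there is exactly one time slot t with t0 ≤ t < t0 + k such that r = (s + t) mod k and p = (i + t) mod k; that is, within any window of k consecutive time slots, input port IP(i,s) is connected to the compatible CIM output port L_CIM(r,p) exactly once. -/
/-- For every `k ≥ 1`, all `i, s, r, p < k` with `(r + i) mod k = (p + s) mod k`, and
every starting slot `t0`, there is exactly one time slot `t` with `t0 ≤ t < t0 + k`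
such that `r = (s + t) mod k` and `p = (i + t) mod k`: within any window of `k`
consecutive slots, `IP(i,s)` is connected to the compatible `L_CIM(r,p)` exactly once. -/
theorem lbc_im_cim_window_unique (k : ℕ) (hk : 1 ≤ k) (i s r p : ℕ)
    (hi : i < k) (hs : s < k) (hr : r < k) (hp : p < k)
    (hcomp : (r + i) % k = (p + s) % k) (t0 : ℕ) :
    ∃! t, (t0 ≤ t ∧ t < t0 + k) ∧ r = (s + t) % k ∧ p = (i + t) % k := by
  have hm : t0 % k < k := Nat.mod_lt _ hk
  have h1 : s + (t0 + (r + (k - s) + (k - t0 % k)) % k) ≡ r [MOD k] := by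
    calc s + (t0 + (r + (k - s) + (k - t0 % k)) % k)
        ≡ s + (t0 % k + (r + (k - s) + (k - t0 % k))) [MOD k] :=
          Nat.ModEq.add_left _ (Nat.ModEq.add (Nat.mod_modEq _ _).symm (Nat.mod_modEq _ _))
      _ = r + k + k := by omega
      _ ≡ r [MOD k] := by simp [Nat.ModEq]
  have hd : (r + (k - s) + (k - t0 % k)) % k < k := Nat.mod_lt _ hk
  generalize (r + (k - s) + (k - t0 % k)) % k = d at h1 hd
  refine ⟨t0 + d, ⟨⟨by omega, by omega⟩, ?_, ?_⟩, ?_⟩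
  · rw [h1, Nat.mod_eq_of_lt hr]
  · have h2 : i + (t0 + d) ≡ p [MOD k] := by
      apply Nat.ModEq.add_right_cancel' s
      calc i + (t0 + d) + s = (s + (t0 + d)) + i := by ring
        _ ≡ r + i [MOD k] := h1.add_right i
        _ ≡ p + s [MOD k] := hcomp
    rw [h2, Nat.mod_eq_of_lt hp]
  · rintro t ⟨⟨ha, hb⟩, hc, -⟩
    obtain ⟨e, rfl⟩ := Nat.exists_eq_add_of_le ha
    have h3 : s + (t0 + e) ≡ s + (t0 + d) [MOD k] :=
      Nat.ModEq.trans (by rw [Nat.ModEq, ← hc, Nat.mod_eq_of_lt hr]) h1.symm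
    have h4 : e ≡ d [MOD k] := (h3.add_left_cancel' s).add_left_cancel' t0
    rw [h4.eq_of_lt_of_lt (by omega) hd]
end

section
/- Let N, k ≥ 1, let σ_0, …, σ_{k−1} be pairwise disjoint permutations of {0,…,N−1} (σ_t(x) ≠ σ_{t'}(x) for t ≠ t'), and let P = Σ_{t<k} M(σ_t) be the compound permutation matrix. Let R1 be an N × N matrix with nonnegative real entries λ_{u,v} that is admissible, i.e., every row sum and every column sum of R1 is at most 1. Define the load-balanced traffic matrix R2 by R2[u,w] = (1/k)·(Σ_v λ_{u,v})·P[u,w]. Then R2 is admissible: every row sum of R2 is at most 1 and every column sum of R2 is at most 1. -/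
/-- Let `N, k ≥ 1`, let `σ_0, …, σ_{k−1}` be pairwise disjoint permutations of
`{0,…,N−1}`, and `P = Σ_{t<k} M(σ t)`. If `R1 = [λ_{u,v}]` has nonnegative entries
and is admissible (all row and column sums at most `1`), then the load-balanced
traffic matrix `R2[u,w] = (1/k) · (Σ_v λ_{u,v}) · P[u,w]` is admissible as well. -/
theorem lbc_load_balanced_traffic_admissible (N k : ℕ) (hN : 1 ≤ N) (hk : 1 ≤ k)
    (σ : Fin k → Equiv.Perm (Fin N))
    (hdisj : ∀ t t' : Fin k, t ≠ t' → ∀ x : Fin N, σ t x ≠ σ t' x)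
    (R1 : Matrix (Fin N) (Fin N) ℝ)
    (hnn : ∀ u v, 0 ≤ R1 u v)
    (hrow : ∀ u, ∑ v, R1 u v ≤ 1)
    (hcol : ∀ v, ∑ u, R1 u v ≤ 1) :
    let P : Matrix (Fin N) (Fin N) ℝ :=
      ∑ t : Fin k, Matrix.of (fun u v : Fin N => if v = σ t u then (1 : ℝ) else 0)
    let R2 : Matrix (Fin N) (Fin N) ℝ :=
      Matrix.of (fun u w : Fin N => (1 / (k : ℝ)) * (∑ v, R1 u v) * P u w)
    (∀ u, ∑ w, R2 u w ≤ 1) ∧ (∀ w, ∑ u, R2 u w ≤ 1) := by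
  intro P R2
  have hk0 : (0 : ℝ) < k := by exact_mod_cast hk
  have hP : ∀ u w, P u w = ∑ t : Fin k, if w = σ t u then (1 : ℝ) else 0 := by
    intro u w
    simp only [P, Matrix.sum_apply, Matrix.of_apply]
  have hP0 : ∀ u w, 0 ≤ P u w := by
    intro u w
    rw [hP]
    exact Finset.sum_nonneg fun t _ => by split_ifs <;> norm_num
  have hle : ∀ u w, R2 u w ≤ (1 / (k : ℝ)) * P u w := by
    intro u w
    simp only [R2, Matrix.of_apply]
    apply mul_le_mul_of_nonneg_right _ (hP0 u w)
    exact mul_le_of_le_one_right (by positivity) (hrow u)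
  constructor
  · intro u
    have h : ∑ w, P u w = k := by
      simp only [hP]
      rw [Finset.sum_comm]
      simp
    calc ∑ w, R2 u w ≤ ∑ w, (1 / (k : ℝ)) * P u w := Finset.sum_le_sum fun w _ => hle u w
      _ = 1 := by rw [← Finset.mul_sum, h]; field_simp
  · intro w
    have h : ∑ u, P u w = k := by
      simp only [hP]
      rw [Finset.sum_comm]
      have h1 : ∀ t : Fin k, ∑ u, (if w = σ t u then (1 : ℝ) else 0) = 1 := by
        intro t
        rw [Equiv.sum_comp (σ t) (fun v => if w = v then (1 : ℝ) else 0)]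
        simp
      simp [h1]
    calc ∑ u, R2 u w ≤ ∑ u, (1 / (k : ℝ)) * P u w := Finset.sum_le_sum fun u _ => hle u w
      _ = 1 := by rw [← Finset.mul_sum, h]; field_simp
end

section
/- Let a, s : ℕ → ℕ be the per-slot arrival and service-opportunity sequences of a discrete-time queue whose occupancy Q : ℕ → ℕ evolves as Q(t+1) = Q(t) + a(t) − min(s(t), Q(t) + a(t)). Suppose there is a constant C ∈ ℕ such that for all t1 ≤ t2 the cumulative arrivals over the interval [t1, t2) are bounded by the cumulative service opportunities plus C, i.e., Σ_{γ=t1}^{t2−1} a(γ) ≤ C + Σ_{γ=t1}^{t2−1} s(γ). Then the queue occupancy is bounded for all time: Q(t) ≤ Q(0) + C for every t ∈ ℕ. In particular each queue of the LBC switch, whose arrivals never exceed its guaranteed periodic service by more than a constant under admissible traffic, is weakly stable. -/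
/-- Discrete-time queue stability: if the occupancy evolves as
`Q(t+1) = Q(t) + a(t) − min(s(t), Q(t) + a(t))` and there is a constant `C` such that
for all `t1 ≤ t2` the cumulative arrivals over `[t1, t2)` are at most the cumulative
service opportunities plus `C`, then `Q(t) ≤ Q(0) + C` for all `t`: the queue is
weakly stable (as are the VOQs, VOMQs and CBs of the LBC switch under admissible
traffic with the guaranteed periodic service). -/
theorem lbc_queue_weakly_stable (a s Q : ℕ → ℕ) (C : ℕ)
    (hQ : ∀ t, Q (t + 1) = Q t + a t - min (s t) (Q t + a t))
    (hC : ∀ t1 t2, t1 ≤ t2 →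
      ∑ γ ∈ Finset.Ico t1 t2, a γ ≤ C + ∑ γ ∈ Finset.Ico t1 t2, s γ) :
    ∀ t, Q t ≤ Q 0 + C := by
  intro t
  have key : ∃ t1, t1 ≤ t ∧
      Q t + ∑ γ ∈ Finset.Ico t1 t, s γ ≤ Q 0 + ∑ γ ∈ Finset.Ico t1 t, a γ := by
    induction t with
    | zero => exact ⟨0, le_refl _, by simp⟩
    | succ t ih =>
      obtain ⟨t1, h1, h2⟩ := ih
      have h := hQ t
      by_cases hs : s t ≤ Q t + a t
      · refine ⟨t1, by omega, ?_⟩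
        rw [Finset.sum_Ico_succ_top h1, Finset.sum_Ico_succ_top h1]
        omega
      · refine ⟨t + 1, le_refl _, ?_⟩
        simp only [Finset.Ico_self, Finset.sum_empty]
        omega
  obtain ⟨t1, h1, h2⟩ := key
  have := hC t1 t h1
  omega
end
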